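/- Assume the transshipment problem is feasible. Under the Physarum dynamics, there exist constants c > 0 and T ≥ 0 such that σ_e(t) ≥ c for all t ≥ T and every arc e ∈ Ĥ, where Ĥ is the set of arcs carried by some minimum-cost positive flow. -/

import Mathlib

open scoped BigOperators

section PhysarumSetup

variable {V E : Type*} [Fintype V] [Fintype E] [DecidableEq V] [DecidableEq E]

/-- Incidence (boundary) matrix of the digraph given by `tail`/`head`:
`+1` if `i` is the tail of `e`, `-1` if `i` is the head of `e`, `0` otherwise. -/
def incMatrix (tail head : E → V) : Matrix V E ℝ :=
  Matrix.of fun i e => if tail e = i then (1 : ℝ) else if head e = i then -1 else 0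

/-- The digraph has no loops. -/
def NoLoops (tail head : E → V) : Prop := ∀ e, tail e ≠ head e

/-- The digraph has no multiple arcs. -/
def NoMultiple (tail head : E → V) : Prop :=
  ∀ e f, tail e = tail f → head e = head f → e = f

/-- Adjacency in the underlying undirected graph. -/
def Adj (tail head : E → V) (i j : V) : Prop :=
  ∃ e, (tail e = i ∧ head e = j) ∨ (tail e = j ∧ head e = i)

/-- The underlying undirected graph is connected. -/
def IsConnectedGraph (tail head : E → V) : Prop :=
  ∀ i j : V, Relation.ReflTransGen (Adj tail head) i j

/-- `φ` is a flow with source vector `b`: `Bφ = b`. -/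
def IsFlow (tail head : E → V) (b : V → ℝ) (φ : E → ℝ) : Prop :=
  (incMatrix tail head).mulVec φ = b

/-- Net supply `b(S)` of a vertex set `S`. -/
def netSupply (b : V → ℝ) (S : Finset V) : ℝ := ∑ i ∈ S, b i

/-- `b*_max = max_{S ⊆ V} |b(S)|`. -/
noncomputable def bstarMax (b : V → ℝ) : ℝ :=
  sSup {x | ∃ S : Finset V, x = |netSupply b S|}

/-- `b*_min = min { |b(S)| : S ⊆ V, b(S) ≠ 0 }`. -/
noncomputable def bstarMin (b : V → ℝ) : ℝ :=
  sInf {x | ∃ S : Finset V, netSupply b S ≠ 0 ∧ x = |netSupply b S|}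

/-- The support of an arc vector. -/
def suppE (φ : E → ℝ) : Set E := {e | φ e ≠ 0}

/-- An arc set is a forest in the underlying undirected graph:
equivalently, it supports no nonzero circulation. -/
def ForestSupport (tail head : E → V) (s : Set E) : Prop :=
  ∀ γ : E → ℝ, (incMatrix tail head).mulVec γ = 0 → (∀ e, γ e ≠ 0 → e ∈ s) → γ = 0

/-- A basic feasible solution: a positive flow whose support is a forest
in the underlying undirected graph. -/
def IsBFS (tail head : E → V) (b : V → ℝ) (f : E → ℝ) : Prop :=
  IsFlow tail head b f ∧ (∀ e, 0 ≤ f e) ∧ ForestSupport tail head (suppE f)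

/-- A vector is circulation free if its support contains no directed cycle:
equivalently, it supports no nonzero nonnegative circulation. -/
def CirculationFree (tail head : E → V) (φ : E → ℝ) : Prop :=
  ∀ γ : E → ℝ, (incMatrix tail head).mulVec γ = 0 → (∀ e, 0 ≤ γ e) →
    (∀ e, γ e ≠ 0 → φ e ≠ 0) → γ = 0

/-- The weighted graph Laplacian `L(σ) = B · diag(σ/ℓ) · Bᵀ`. -/
noncomputable def lap (tail head : E → V) (ℓ σ : E → ℝ) : Matrix V V ℝ :=
  incMatrix tail head * Matrix.diagonal (fun e => σ e / ℓ e) * (incMatrix tail head).transpose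

/-- The field (slope) of a potential: `Ψ(p)_{ij} = (p_i - p_j)/ℓ_{ij}`. -/
noncomputable def field (tail head : E → V) (ℓ : E → ℝ) (p : V → ℝ) : E → ℝ :=
  fun e => (p (tail e) - p (head e)) / ℓ e

/-- The set of vertices incident to an arc set `H`. -/
def VSet (tail head : E → V) (H : Set E) : Set V :=
  {i | ∃ e ∈ H, tail e = i ∨ head e = i}

/-- Undirected reachability using only arcs in `H`. -/
def UReach (tail head : E → V) (H : Set E) : V → V → Prop :=
  Relation.ReflTransGen
    (fun i j => ∃ e ∈ H, (tail e = i ∧ head e = j) ∨ (tail e = j ∧ head e = i))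

/-- `WalkLen tail head ℓ H i j L`: there is a walk in the underlying undirected
graph of `H` from `i` to `j` of total `ℓ`-length `L`. -/
inductive WalkLen (tail head : E → V) (ℓ : E → ℝ) (H : Set E) : V → V → ℝ → Prop
  | refl (i : V) : WalkLen tail head ℓ H i i 0
  | step {j k : V} {L : ℝ} (i : V) (e : E) (he : e ∈ H)
      (hik : (tail e = i ∧ head e = j) ∨ (tail e = j ∧ head e = i))
      (hw : WalkLen tail head ℓ H j k L) : WalkLen tail head ℓ H i k (ℓ e + L)

/-- The minimal `ℓ`-length of a connecting walk within `H`. -/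
noncomputable def wdist (tail head : E → V) (ℓ : E → ℝ) (H : Set E) (i j : V) : ℝ :=
  sInf {L | WalkLen tail head ℓ H i j L}

/-- The `ℓ`-diameter of `H`: the maximum of `wdist` over pairs of vertices lying in
a common component of `H`. -/
noncomputable def wdiam (tail head : E → V) (ℓ : E → ℝ) (H : Set E) : ℝ :=
  sSup {x | ∃ i j : V, (∃ L, WalkLen tail head ℓ H i j L) ∧ x = wdist tail head ℓ H i j}

/-- Maximum norm of `p` restricted to a vertex set `A`. -/
noncomputable def supNormOn (A : Set V) (p : V → ℝ) : ℝ := sSup {x | ∃ i ∈ A, x = |p i|}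

/-- Maximum norm of an arc vector. -/
noncomputable def eSupNorm (x : E → ℝ) : ℝ := sSup {r | ∃ e : E, r = |x e|}

/-- `min { σ_e : σ_e > 0 }`. -/
noncomputable def minPos (σ : E → ℝ) : ℝ := sInf {x | ∃ e, 0 < σ e ∧ x = σ e}

/-- `min_e ℓ_e`. -/
noncomputable def minLen (ℓ : E → ℝ) : ℝ := sInf {x | ∃ e : E, x = ℓ e}

/-- The cost `ℓᵀφ` of a flow. -/
def cost (ℓ φ : E → ℝ) : ℝ := ∑ e, ℓ e * φ e

/-- The transshipment problem is feasible: there is a positive flow. -/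
def Feasible (tail head : E → V) (b : V → ℝ) : Prop :=
  ∃ φ : E → ℝ, IsFlow tail head b φ ∧ ∀ e, 0 ≤ φ e

/-- `φ` is a minimum-cost positive flow. -/
def IsOptimal (tail head : E → V) (ℓ : E → ℝ) (b : V → ℝ) (φ : E → ℝ) : Prop :=
  IsFlow tail head b φ ∧ (∀ e, 0 ≤ φ e) ∧
    ∀ ψ : E → ℝ, IsFlow tail head b ψ → (∀ e, 0 ≤ ψ e) → cost ℓ φ ≤ cost ℓ ψ

/-- `Ĥ`: the set of arcs carried by some minimum-cost positive flow. -/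
def optSupport (tail head : E → V) (ℓ : E → ℝ) (b : V → ℝ) : Set E :=
  {e | ∃ φ : E → ℝ, IsOptimal tail head ℓ b φ ∧ 0 < φ e}

/-- The current `φ(t) = σ(t)·Ψ(p(t))` of the Physarum solver. -/
noncomputable def current (tail head : E → V) (ℓ : E → ℝ) (σ : ℝ → E → ℝ)
    (p : ℝ → V → ℝ) (t : ℝ) : E → ℝ :=
  fun e => σ t e * field tail head ℓ (p t) e

/-- The Physarum dynamics: `σ(t) > 0` and continuously differentiable on `[0,∞)`,
`L(σ(t)) p(t) = b`, and `σ' = φ - σ` where `φ(t) = σ(t)·Ψ(p(t))`. -/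
structure PhysarumDynamics (tail head : E → V) (ℓ : E → ℝ) (b : V → ℝ)
    (σ : ℝ → E → ℝ) (p : ℝ → V → ℝ) : Prop where
  pos : ∀ t : ℝ, 0 ≤ t → ∀ e, 0 < σ t e
  kirchhoff : ∀ t : ℝ, 0 ≤ t → (lap tail head ℓ (σ t)).mulVec (p t) = b
  contp : ContinuousOn (fun t => p t) (Set.Ici (0 : ℝ))
  dyn : ∀ t ∈ Set.Ici (0 : ℝ), ∀ e : E,
    HasDerivWithinAt (fun s => σ s e)
      (current tail head ℓ σ p t e - σ t e) (Set.Ici (0 : ℝ)) t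

/-- A directed walk from `i` to `j` using the listed arcs in order. -/
inductive DiWalk (tail head : E → V) : V → V → List E → Prop
  | nil (i : V) : DiWalk tail head i i []
  | cons {j k : V} {es : List E} (i : V) (e : E) (h1 : tail e = i) (h2 : head e = j)
      (hw : DiWalk tail head j k es) : DiWalk tail head i k (e :: es)

/-- Discrete `∞`-harmonicity of `p` at node `i` with respect to the arc set `H`:
the maximal in-slope equals the maximal out-slope, and both are nonnegative. -/
noncomputable def InfHarmAt (tail head : E → V) (ℓ : E → ℝ) (H : Set E)
    (p : V → ℝ) (i : V) : Prop :=
  sSup {r | ∃ e ∈ H, head e = i ∧ r = (p (tail e) - p i) / ℓ e}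
    = sSup {r | ∃ e ∈ H, tail e = i ∧ r = (p i - p (head e)) / ℓ e}
  ∧ 0 ≤ sSup {r | ∃ e ∈ H, tail e = i ∧ r = (p i - p (head e)) / ℓ e}

end PhysarumSetup

/-- The **Farkas lemma** for finitely many linear functionals. -/
lemma exists_nonneg_combination {M ι : Type*} [AddCommGroup M] [Module ℝ M] [DecidableEq ι]
    (s : Finset ι) (a : ι → M →ₗ[ℝ] ℝ) (c : M →ₗ[ℝ] ℝ)
    (h : ∀ x, (∀ i ∈ s, 0 ≤ a i x) → 0 ≤ c x) :
    ∃ y : ι → ℝ, (∀ i, 0 ≤ y i) ∧ ∀ x, c x = ∑ i ∈ s, y i * a i x := by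
  induction s using Finset.induction_on generalizing a c with
  | empty =>
    refine ⟨0, fun _ => le_rfl, fun x => ?_⟩
    have h1 := h x (by simp)
    have h2 := h (-x) (by simp)
    rw [map_neg] at h2
    simp only [Finset.sum_empty]
    linarith
  | insert j s hj ih =>
    by_cases hc : ∀ x, (∀ i ∈ s, 0 ≤ a i x) → 0 ≤ c x
    · obtain ⟨y, hy, hyc⟩ := ih a c hc
      refine ⟨Function.update y j 0, fun i => ?_, fun x => ?_⟩
      · rcases eq_or_ne i j with rfl | hij
        · simp
        · simpa [hij] using hy i
      · rw [Finset.sum_insert hj, hyc x]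
        simp only [Function.update_self, zero_mul, zero_add]
        refine Finset.sum_congr rfl fun i hi => ?_
        rw [Function.update_of_ne (ne_of_mem_of_not_mem hi hj)]
    · push Not at hc
      obtain ⟨u, hu, hcu⟩ := hc
      have hju : a j u < 0 := by
        by_contra! hcon
        exact absurd (h u (by simpa [hcon] using hu)) (not_le.mpr hcu)
      -- Project along `u` onto the kernel of `a j`.
      have key : ∀ x, (∀ i ∈ s, 0 ≤ (a i - (a i u / a j u) • a j) x) →
          0 ≤ (c - (c u / a j u) • a j) x := by
        intro x hx
        have := h (x - (a j x / a j u) • u) ?_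
        · simp only [map_sub, map_smul, smul_eq_mul, LinearMap.sub_apply,
            LinearMap.smul_apply] at this ⊢
          convert this using 1
          ring
        · intro i hi
          simp only [map_sub, map_smul, smul_eq_mul]
          rcases Finset.mem_insert.mp hi with rfl | hi
          · rw [div_mul_cancel₀ _ hju.ne, sub_self]
          · have := hx i hi
            simp only [LinearMap.sub_apply, LinearMap.smul_apply, smul_eq_mul] at this
            convert this using 1
            ring
      obtain ⟨y, hy, hyc⟩ := ih _ _ key
      refine ⟨Function.update y j (c u / a j u - ∑ i ∈ s, y i * (a i u / a j u)),
        fun i => ?_, fun x => ?_⟩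
      · rcases eq_or_ne i j with rfl | hij
        · have h1 : 0 ≤ c u / a i u := div_nonneg_of_nonpos hcu.le hju.le
          have h2 : ∑ k ∈ s, y k * (a k u / a i u) ≤ 0 := Finset.sum_nonpos fun k hk =>
            mul_nonpos_of_nonneg_of_nonpos (hy k)
              (div_nonpos_of_nonneg_of_nonpos (hu k hk) hju.le)
          simp only [Function.update_self]
          linarith
        · simpa [hij] using hy i
      · have hx := hyc x
        simp only [LinearMap.sub_apply, LinearMap.smul_apply, smul_eq_mul, mul_sub,
          Finset.sum_sub_distrib] at hx
        have hsum : ∑ i ∈ s, Function.update y j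
            (c u / a j u - ∑ i ∈ s, y i * (a i u / a j u)) i * a i x
            = ∑ i ∈ s, y i * a i x := by
          refine Finset.sum_congr rfl fun i hi => ?_
          rw [Function.update_of_ne (ne_of_mem_of_not_mem hi hj)]
        rw [Finset.sum_insert hj, hsum, Function.update_self, sub_mul, Finset.sum_mul]
        simp only [mul_assoc] at hx ⊢
        linarith

section Physarum

variable {V E : Type*} [Fintype V] [DecidableEq V]

lemma incMatrix_transpose_mulVec {tail head : E → V} (hloops : NoLoops tail head)
    (p : V → ℝ) (e : E) :
    (incMatrix tail head).transpose.mulVec p e = p (tail e) - p (head e) := by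
  have h : ∀ i, (incMatrix tail head).transpose e i * p i =
      (if tail e = i then p i else 0) - (if head e = i then p i else 0) := by
    intro i
    have := hloops e
    simp only [incMatrix, Matrix.transpose_apply, Matrix.of_apply]
    split_ifs <;> simp_all
  simp only [Matrix.mulVec, dotProduct, h, Finset.sum_sub_distrib]
  simp

variable [Fintype E]

/-- Discrete integration by parts. -/
lemma dotProduct_incMatrix_mulVec {tail head : E → V} (hloops : NoLoops tail head)
    (p : V → ℝ) (φ : E → ℝ) :
    p ⬝ᵥ (incMatrix tail head).mulVec φ = ∑ e, (p (tail e) - p (head e)) * φ e := by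
  rw [Matrix.dotProduct_mulVec, ← Matrix.mulVec_transpose, dotProduct]
  simp only [incMatrix_transpose_mulVec hloops]

/-- Strong duality for the transshipment problem: an optimal potential exists. -/
lemma IsOptimal.exists_potential {tail head : E → V} (hloops : NoLoops tail head)
    {ℓ : E → ℝ} (hℓ : ∀ e, 0 < ℓ e) {b : V → ℝ} {φ : E → ℝ}
    (hφ : IsOptimal tail head ℓ b φ) :
    ∃ q : V → ℝ, (∀ e, q (tail e) - q (head e) ≤ ℓ e) ∧ cost ℓ φ ≤ q ⬝ᵥ b := by
  classical
  by_contra! hcon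
  let π (i : V) : (V → ℝ) × ℝ →ₗ[ℝ] ℝ := LinearMap.proj i ∘ₗ LinearMap.fst ℝ _ _
  let z : (V → ℝ) × ℝ →ₗ[ℝ] ℝ := LinearMap.snd ℝ _ _
  let a : Option E → (V → ℝ) × ℝ →ₗ[ℝ] ℝ := fun o => o.elim
    (∑ i, b i • π i - cost ℓ φ • z) (fun e => ℓ e • z - (π (tail e) - π (head e)))
  have ha_none : ∀ x, a none x = x.1 ⬝ᵥ b - cost ℓ φ * x.2 := by
    intro x
    simp [a, π, z, dotProduct, mul_comm]
  have ha_some : ∀ e x, a (some e) x = ℓ e * x.2 - (x.1 (tail e) - x.1 (head e)) := by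
    intro e x
    simp [a, π, z]
  obtain ⟨y, hy, hyz⟩ := exists_nonneg_combination Finset.univ a (-z) (by
    intro x hx
    by_contra! hz
    replace hz : 0 < x.2 := by simpa [z] using hz
    refine (hcon (x.2⁻¹ • x.1) fun e => ?_).not_ge ?_
    · have := hx (some e) (Finset.mem_univ _)
      rw [ha_some] at this
      simp only [Pi.smul_apply, smul_eq_mul, ← mul_sub]
      rw [inv_mul_le_iff₀ hz]
      linarith
    · have := hx none (Finset.mem_univ _)
      rw [ha_none] at this
      rw [smul_dotProduct, smul_eq_mul, le_inv_mul_iff₀ hz]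
      linarith)
  simp only [Fintype.sum_option, ha_none, ha_some] at hyz
  have hcost : -1 = -(y none * cost ℓ φ) + ∑ e, y (some e) * ℓ e := by
    simpa [z] using hyz (0, 1)
  have hflow : (incMatrix tail head).mulVec (fun e => y (some e)) = y none • b := by
    refine dotProduct_eq _ _ fun p => ?_
    have := hyz (p, 0)
    simp only [LinearMap.neg_apply, LinearMap.snd_apply, z, mul_zero, sub_zero, zero_sub,
      mul_neg, Finset.sum_neg_distrib, neg_zero] at this
    rw [dotProduct_comm, dotProduct_incMatrix_mulVec hloops, dotProduct_comm,
      dotProduct_smul, smul_eq_mul]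
    simp only [mul_comm (y (some _))] at this
    linarith
  have hpos : 0 ≤ ∑ e, y (some e) * ℓ e :=
    Finset.sum_nonneg fun e _ => mul_nonneg (hy _) (hℓ e).le
  have hy0 : 0 < y none := by
    refine (hy none).lt_of_ne fun h0 => ?_
    rw [← h0] at hcost
    linarith
  have hopt := hφ.2.2 ((y none)⁻¹ • fun e => y (some e))
    (by rw [IsFlow, Matrix.mulVec_smul, hflow, inv_smul_smul₀ hy0.ne'])
    (fun e => mul_nonneg (inv_nonneg.mpr hy0.le) (hy _))
  have hscale : cost ℓ ((y none)⁻¹ • fun e => y (some e))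
      = (y none)⁻¹ * ∑ e, y (some e) * ℓ e := by
    simp only [cost, Pi.smul_apply, smul_eq_mul, Finset.mul_sum]
    exact Finset.sum_congr rfl fun e _ => by ring
  rw [hscale, le_inv_mul_iff₀ hy0] at hopt
  linarith

lemma PhysarumDynamics.isFlow_current [DecidableEq E] {tail head : E → V}
    (hloops : NoLoops tail head)
    {ℓ : E → ℝ} {b : V → ℝ} {σ : ℝ → E → ℝ} {p : ℝ → V → ℝ}
    (hdyn : PhysarumDynamics tail head ℓ b σ p) {t : ℝ} (ht : 0 ≤ t) :
    IsFlow tail head b (current tail head ℓ σ p t) := by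
  rw [IsFlow, ← hdyn.kirchhoff t ht, lap, ← Matrix.mulVec_mulVec, ← Matrix.mulVec_mulVec]
  congr 1
  ext e
  rw [Matrix.mulVec_diagonal, incMatrix_transpose_mulVec hloops, current, field]
  ring

/-- The contribution of one arc to the entropy-like Lyapunov function. -/
noncomputable def arcEntropy (l f d s : ℝ) : ℝ := l * f * Real.log s - (2 * l - d) * s

lemma mul_log_le_add {a x : ℝ} (ha : 0 ≤ a) (hx : 0 < x) :
    a * Real.log x ≤ x + a * Real.log a := by
  rcases ha.eq_or_lt with rfl | ha
  · simpa using hx.le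
  · have h := Real.log_le_sub_one_of_pos (div_pos hx ha)
    rw [Real.log_div hx.ne' ha.ne'] at h
    have h2 := mul_le_mul_of_nonneg_left h ha.le
    have h3 : a * (x / a - 1) = x - a := by field_simp
    rw [h3] at h2
    linarith

lemma arcEntropy_le {l f d s : ℝ} (hl : 0 < l) (hf : 0 ≤ f) (hd : d ≤ l) (hs : 0 < s) :
    arcEntropy l f d s ≤ l * (f * Real.log f) := by
  have h1 := mul_le_mul_of_nonneg_left (mul_log_le_add hf hs) hl.le
  have h2 := mul_le_mul_of_nonneg_right hd hs.le
  unfold arcEntropy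
  linarith

lemma arcEntropy_le_log {l f d s : ℝ} (hl : 0 < l) (hd : d ≤ l) (hs : 0 < s) :
    arcEntropy l f d s ≤ l * f * Real.log s := by
  have h : 0 ≤ (2 * l - d) * s := mul_nonneg (by linarith) hs.le
  unfold arcEntropy
  linarith

/-- The total entropy is nondecreasing along the Physarum dynamics. -/
lemma PhysarumDynamics.monotoneOn_entropy [DecidableEq E] {tail head : E → V}
    (hloops : NoLoops tail head) {ℓ : E → ℝ} (hℓ : ∀ e, 0 < ℓ e) {b : V → ℝ}
    {σ : ℝ → E → ℝ} {p : ℝ → V → ℝ} (hdyn : PhysarumDynamics tail head ℓ b σ p)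
    {φ : E → ℝ} (hφ : IsFlow tail head b φ) {q : V → ℝ}
    (hq : ∀ e, q (tail e) - q (head e) ≤ ℓ e) (hcost : cost ℓ φ ≤ q ⬝ᵥ b) :
    MonotoneOn (fun t => ∑ e, arcEntropy (ℓ e) (φ e) (q (tail e) - q (head e)) (σ t e))
      (Set.Ici 0) := by
  let Ψ := fun t => field tail head ℓ (p t)
  let G' := fun t => ∑ e, (ℓ e * φ e * (Ψ t e - 1)
    - (2 * ℓ e - (q (tail e) - q (head e))) * (σ t e * Ψ t e - σ t e))
  have hderiv : ∀ t ∈ Set.Ici (0 : ℝ), HasDerivWithinAt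
      (fun t => ∑ e, arcEntropy (ℓ e) (φ e) (q (tail e) - q (head e)) (σ t e))
      (G' t) (Set.Ici 0) t := by
    intro t ht
    refine HasDerivWithinAt.fun_sum fun e _ => ?_
    have hσ := hdyn.dyn t ht e
    have hne := (hdyn.pos t ht e).ne'
    have hlog : HasDerivWithinAt (fun s => Real.log (σ s e)) (Ψ t e - 1) (Set.Ici 0) t := by
      convert hσ.log hne using 1
      simp only [current, Ψ]
      field_simp
    exact (hlog.const_mul _).sub (hσ.const_mul _)
  refine monotoneOn_of_hasDerivWithinAt_nonneg (f' := G') (convex_Ici 0)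
    (fun t ht => (hderiv t ht).continuousWithinAt)
    (fun t ht => (hderiv t (interior_subset ht)).mono interior_subset) fun t ht => ?_
  replace ht : 0 ≤ t := interior_subset ht
  have hcur := hdyn.isFlow_current hloops ht
  have hfield : ∀ e, p t (tail e) - p t (head e) = ℓ e * Ψ t e := fun e => by
    simp only [Ψ, field]
    rw [mul_div_cancel₀ _ (hℓ e).ne']
  -- Both `φ` and the current pair with `p t` to give `p t ⬝ᵥ b`.
  have henergy : ∑ e, ℓ e * Ψ t e * φ e = ∑ e, ℓ e * Ψ t e * (σ t e * Ψ t e) := by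
    have h1 := dotProduct_incMatrix_mulVec hloops (p t) φ
    have h2 := dotProduct_incMatrix_mulVec hloops (p t) (current tail head ℓ σ p t)
    rw [hφ] at h1
    rw [hcur] at h2
    simp only [hfield] at h1 h2
    exact h1.symm.trans h2
  have hdual : ∑ e, ℓ e * φ e ≤ ∑ e, (q (tail e) - q (head e)) * (σ t e * Ψ t e) := by
    have h1 := dotProduct_incMatrix_mulVec hloops q (current tail head ℓ σ p t)
    rw [hcur] at h1
    exact hcost.trans h1.le
  have hsq : 0 ≤ ∑ e, (ℓ e * σ t e * (Ψ t e - 1) ^ 2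
      + (ℓ e - (q (tail e) - q (head e))) * σ t e) :=
    Finset.sum_nonneg fun e _ => add_nonneg
      (mul_nonneg (mul_nonneg (hℓ e).le (hdyn.pos t ht e).le) (sq_nonneg _))
      (mul_nonneg (sub_nonneg.mpr (hq e)) (hdyn.pos t ht e).le)
  have hsplit : G' t = ∑ e, (ℓ e * σ t e * (Ψ t e - 1) ^ 2
        + (ℓ e - (q (tail e) - q (head e))) * σ t e)
      + (∑ e, ℓ e * Ψ t e * φ e - ∑ e, ℓ e * Ψ t e * (σ t e * Ψ t e))
      + (∑ e, (q (tail e) - q (head e)) * (σ t e * Ψ t e) - ∑ e, ℓ e * φ e) := by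
    simp only [G', ← Finset.sum_sub_distrib, ← Finset.sum_add_distrib]
    exact Finset.sum_congr rfl fun e _ => by ring
  rw [hsplit]
  linarith

lemma PhysarumDynamics.exists_pos_le_of_mem_optSupport [DecidableEq E] {tail head : E → V}
    (hloops : NoLoops tail head) {ℓ : E → ℝ} (hℓ : ∀ e, 0 < ℓ e) {b : V → ℝ}
    {σ : ℝ → E → ℝ} {p : ℝ → V → ℝ} (hdyn : PhysarumDynamics tail head ℓ b σ p)
    {e : E} (he : e ∈ optSupport tail head ℓ b) :
    ∃ c > 0, ∀ t, 0 ≤ t → c ≤ σ t e := by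
  obtain ⟨φ, hφ, hφe⟩ := he
  obtain ⟨q, hq, hcost⟩ := hφ.exists_potential hloops hℓ
  have hmono := hdyn.monotoneOn_entropy hloops hℓ hφ.1 hq hcost
  let K := ∑ f, arcEntropy (ℓ f) (φ f) (q (tail f) - q (head f)) (σ 0 f)
    - ∑ f ∈ Finset.univ.erase e, ℓ f * (φ f * Real.log (φ f))
  refine ⟨Real.exp (K / (ℓ e * φ e)), Real.exp_pos _, fun t ht => ?_⟩
  have hpos := hdyn.pos t ht
  rw [← Real.le_log_iff_exp_le (hpos e), div_le_iff₀' (mul_pos (hℓ e) hφe)]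
  refine le_trans ?_ (arcEntropy_le_log (hℓ e) (hq e) (hpos e))
  have h1 := hmono Set.self_mem_Ici ht ht
  have h2 : ∑ f ∈ Finset.univ.erase e,
      arcEntropy (ℓ f) (φ f) (q (tail f) - q (head f)) (σ t f)
      ≤ ∑ f ∈ Finset.univ.erase e, ℓ f * (φ f * Real.log (φ f)) :=
    Finset.sum_le_sum fun f _ => arcEntropy_le (hℓ f) (hφ.2.1 f) (hq f) (hpos f)
  have h3 := Finset.add_sum_erase Finset.univ
    (fun f => arcEntropy (ℓ f) (φ f) (q (tail f) - q (head f)) (σ t f)) (Finset.mem_univ e)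
  simp only [K] at *
  linarith

end Physarum

theorem statement_12 {V E : Type*} [Fintype V] [Fintype E] [DecidableEq V] [DecidableEq E]
    (tail head : E → V)
    (hloops : NoLoops tail head) (hmult : NoMultiple tail head)
    (hconn : IsConnectedGraph tail head)
    (ℓ : E → ℝ) (hℓ : ∀ e, 0 < ℓ e)
    (b : V → ℝ) (hb : ∑ i, b i = 0)
    (hfeas : Feasible tail head b)
    (σ : ℝ → E → ℝ) (p : ℝ → V → ℝ)
    (hdyn : PhysarumDynamics tail head ℓ b σ p) :
    ∃ c > (0:ℝ), ∃ T : ℝ, 0 ≤ T ∧ ∀ t : ℝ, T ≤ t →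
      ∀ e ∈ optSupport tail head ℓ b, c ≤ σ t e := by
  have h : ∀ e, ∃ c > 0, e ∈ optSupport tail head ℓ b → ∀ t, 0 ≤ t → c ≤ σ t e := by
    intro e
    by_cases he : e ∈ optSupport tail head ℓ b
    · obtain ⟨c, hc, hle⟩ := hdyn.exists_pos_le_of_mem_optSupport hloops hℓ he
      exact ⟨c, hc, fun _ => hle⟩
    · exact ⟨1, one_pos, fun h => absurd h he⟩
  choose c hc hle using h
  obtain ⟨c₀, hc₀, hmin⟩ := Pi.exists_forall_pos_add_lt (x := 0) (y := c) hc
  refine ⟨c₀, hc₀, 0, le_rfl, fun t ht e he => le_trans ?_ (hle e he t ht)⟩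
  simpa using (hmin e).le
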